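/- Fix c₁ > 0 and c₀ ∈ ℝ, and set s_b := √(1/4 + 1/c₁), s_a := −s_b, a := J_{c₁,c₀}(s_a) and b := J_{c₁,c₀}(s_b) (real values, using the real logarithm since (s±1/2)-ratio is positive there). Then: for every real x with a < x < b there exists exactly one s ∈ ℂ with Im s > 0 and J_{c₁,c₀}(s) = x; and for every real x with x ≤ a or x ≥ b there is no s ∈ ℂ with Im s > 0 and J_{c₁,c₀}(s) = x. -/

import Mathlib

/-- The map `J_{c₁,c₀}(s) = c₁·s + c₀ − Log((s − 1/2)/(s + 1/2))`, with the principal branch of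
the complex logarithm. -/
noncomputable def Jmap (c₁ c₀ : ℝ) (s : ℂ) : ℂ :=
  c₁ * s + c₀ - Complex.log ((s - 1/2) / (s + 1/2))

open Real in
/-- The point `s` of the upper half plane with `(s - 1/2) / (s + 1/2) = exp (p + θ * I)`. -/
noncomputable def halfPlanePoint (p θ : ℝ) : ℂ :=
  ⟨-sinh p / (2 * (cosh p - cos θ)), sin θ / (2 * (cosh p - cos θ))⟩

/-- The pairs `(p, θ)` for which `Jmap c₁ c₀ (halfPlanePoint p θ)` is real, with `k = c₁ / 2`. -/
def OnRealCurve (k p θ : ℝ) : Prop :=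
  0 < θ ∧ θ < Real.pi ∧ θ * Real.cosh p = θ * Real.cos θ + k * Real.sin θ

section Real

open Real

lemma mul_sin_lt_mul_sin {u v : ℝ} (hu : 0 < u) (huv : u < v) (huπ : u < π) (hv : v < 2 * π) :
    u * sin v < v * sin u := by
  have hsu : 0 < sin u := sin_pos_of_pos_of_lt_pi hu huπ
  rcases le_or_gt v π with hvπ | hvπ
  · have h := strictConcaveOn_sin_Icc.slope_anti_adjacent (x := 0) (y := u) (z := v)
      ⟨le_rfl, pi_pos.le⟩ ⟨by linarith, hvπ⟩ hu huv
    rw [sin_zero, sub_zero, sub_zero, div_lt_div_iff₀ (by linarith) hu] at h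
    linarith
  · have : sin v < 0 := by
      have h := sin_pos_of_pos_of_lt_pi (x := v - π) (by linarith) (by linarith)
      rw [sin_sub_pi] at h
      linarith
    nlinarith

lemma mul_cos_mul_sin_lt {x y : ℝ} (hx : 0 < x) (hxy : x < y) (hy : y < π) :
    y * cos y * sin x < x * cos x * sin y := by
  have h := mul_sin_lt_mul_sin (u := y - x) (v := x + y) (by linarith) (by linarith)
    (by linarith) (by linarith)
  rw [sin_sub, sin_add] at h
  linarith

lemma mul_cos_lt_sin {x : ℝ} (hx : 0 < x) (hxπ : x < π) : x * cos x < sin x := by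
  rcases lt_or_ge x (π / 2) with h | h
  · have hc : 0 < cos x := cos_pos_of_mem_Ioo ⟨by linarith, h⟩
    have ht := lt_tan hx h
    rwa [tan_eq_sin_div_cos, lt_div_iff₀ hc] at ht
  · have hc : cos x ≤ 0 := cos_nonpos_of_pi_div_two_le_of_le h (by linarith)
    have := sin_pos_of_pos_of_lt_pi hx hxπ
    nlinarith

namespace OnRealCurve

variable {k p θ p₁ θ₁ p₂ θ₂ : ℝ}

lemma sin_pos (h : OnRealCurve k p θ) : 0 < sin θ := sin_pos_of_pos_of_lt_pi h.1 h.2.1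

lemma sq_div_sin_mul_sinh (h : OnRealCurve k p θ) :
    (θ / sin θ * sinh p) ^ 2 = k ^ 2 + 2 * k * (θ * cos θ / sin θ) - θ ^ 2 := by
  have hs := h.sin_pos.ne'
  have h3 := h.2.2
  have h4 := sin_sq_add_cos_sq θ
  have h5 := cosh_sq p
  field_simp
  linear_combination (θ * cosh p + (θ * cos θ + k * sin θ)) * h3 - θ ^ 2 * h5 + θ ^ 2 * h4

lemma abs_add (h : OnRealCurve k p θ) :
    |p + θ / sin θ * sinh p| = |p| + |θ / sin θ * sinh p| := by
  have hu : 0 < θ / sin θ := div_pos h.1 h.sin_pos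
  rw [abs_add_eq_add_abs_iff]
  rcases le_total 0 p with hp | hp
  · exact Or.inl ⟨hp, mul_nonneg hu.le (sinh_nonneg_iff.2 hp)⟩
  · exact Or.inr ⟨hp, mul_nonpos_of_nonneg_of_nonpos hu.le (sinh_nonpos_iff.2 hp)⟩

lemma abs_lt_of_lt (hk : 0 < k) (h₁ : OnRealCurve k p₁ θ₁) (h₂ : OnRealCurve k p₂ θ₂)
    (hθ : θ₁ < θ₂) :
    |p₂ + θ₂ / sin θ₂ * sinh p₂| < |p₁ + θ₁ / sin θ₁ * sinh p₁| := by
  have hs₁ := h₁.sin_pos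
  have hs₂ := h₂.sin_pos
  have hθ₁ := h₁.1
  have hθ₂ := h₂.1
  rw [h₁.abs_add, h₂.abs_add]
  refine add_lt_add ?_ ?_
  · rw [← cosh_lt_cosh]
    have hc : cos θ₂ < cos θ₁ := cos_lt_cos_of_nonneg_of_le_pi h₁.1.le h₂.2.1.le hθ
    have hsin := mul_sin_lt_mul_sin h₁.1 hθ h₁.2.1 (by linarith [h₂.2.1])
    refine lt_of_mul_lt_mul_left ?_ (mul_pos hθ₁ hθ₂).le
    have e₁ : θ₁ * θ₂ * cosh p₁ = θ₁ * θ₂ * cos θ₁ + k * (θ₂ * sin θ₁) := by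
      linear_combination θ₂ * h₁.2.2
    have e₂ : θ₁ * θ₂ * cosh p₂ = θ₁ * θ₂ * cos θ₂ + k * (θ₁ * sin θ₂) := by
      linear_combination θ₁ * h₂.2.2
    rw [e₁, e₂]
    gcongr
  · rw [← sq_lt_sq, h₁.sq_div_sin_mul_sinh, h₂.sq_div_sin_mul_sinh]
    have hcot : θ₂ * cos θ₂ / sin θ₂ < θ₁ * cos θ₁ / sin θ₁ := by
      rw [div_lt_div_iff₀ hs₂ hs₁]
      exact mul_cos_mul_sin_lt hθ₁ hθ h₂.2.1
    gcongr

lemma eq_of_eq (hk : 0 < k) (h₁ : OnRealCurve k p₁ θ₁) (h₂ : OnRealCurve k p₂ θ₂)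
    (h : p₁ + θ₁ / sin θ₁ * sinh p₁ = p₂ + θ₂ / sin θ₂ * sinh p₂) : p₁ = p₂ ∧ θ₁ = θ₂ := by
  rcases lt_trichotomy θ₁ θ₂ with hθ | rfl | hθ
  · exact absurd (abs_lt_of_lt hk h₁ h₂ hθ) (by rw [h]; exact lt_irrefl _)
  · have hu : 0 < θ₁ / sin θ₁ := div_pos h₁.1 h₁.sin_pos
    have hmono : StrictMono fun p => p + θ₁ / sin θ₁ * sinh p :=
      strictMono_id.add (sinh_strictMono.const_mul hu)
    exact ⟨hmono.injective h, rfl⟩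
  · exact absurd (abs_lt_of_lt hk h₂ h₁ hθ) (by rw [h]; exact lt_irrefl _)

lemma abs_lt (hk : 0 < k) (h : OnRealCurve k p θ) :
    |p + θ / sin θ * sinh p| < arcosh (1 + k) + √((1 + k) ^ 2 - 1) := by
  have hθ := h.1
  have hs := h.sin_pos
  rw [h.abs_add]
  refine add_lt_add ?_ ?_
  · rw [← abs_of_nonneg (arcosh_nonneg (x := 1 + k) (by linarith)), ← cosh_lt_cosh,
      cosh_arcosh (by linarith)]
    refine lt_of_mul_lt_mul_left ?_ hθ.le
    have hsin := sin_lt hθ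
    have hcos : cos θ ≤ 1 := cos_le_one θ
    rw [h.2.2]
    nlinarith
  · refine lt_sqrt_of_sq_lt ?_
    rw [sq_abs, h.sq_div_sin_mul_sinh]
    have hcot : θ * cos θ / sin θ < 1 := (div_lt_one hs).2 (mul_cos_lt_sin hθ h.2.1)
    nlinarith [sq_pos_of_pos hθ]

end OnRealCurve

lemma sinc_pos {θ : ℝ} (h0 : 0 ≤ θ) (hπ : θ < π) : 0 < sinc θ := by
  rcases h0.eq_or_lt with rfl | h0
  · simp
  · rw [sinc_of_ne_zero h0.ne']
    exact div_pos (sin_pos_of_pos_of_lt_pi h0 hπ) h0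

lemma antitoneOn_cos_add_mul_sinc {k : ℝ} (hk : 0 < k) :
    AntitoneOn (fun θ => cos θ + k * sinc θ) (Set.Icc 0 π) := by
  intro x hx y hy hxy
  have hcos : cos y ≤ cos x := cos_le_cos_of_nonneg_of_le_pi hx.1 hy.2 hxy
  have hsinc : sinc y ≤ sinc x := by
    rcases hx.1.eq_or_lt with h0 | h0
    · rw [← h0, sinc_zero]
      exact sinc_le_one y
    · rcases hxy.eq_or_lt with rfl | hlt
      · rfl
      · rw [sinc_of_ne_zero h0.ne', sinc_of_ne_zero (h0.trans hlt).ne',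
          div_le_div_iff₀ (h0.trans hlt) h0]
        have := mul_sin_lt_mul_sin h0 hlt (hlt.trans_le hy.2) (by linarith [hy.2, pi_pos])
        linarith
  dsimp only
  gcongr

lemma exists_onRealCurve_of_nonneg {k y : ℝ} (hk : 0 < k) (hy : 0 ≤ y)
    (hlt : y < arcosh (1 + k) + √((1 + k) ^ 2 - 1)) :
    ∃ p θ, OnRealCurve k p θ ∧ p + θ / sin θ * sinh p = y := by
  set g : ℝ → ℝ := fun θ => cos θ + k * sinc θ with hg
  have hgc : Continuous g := by fun_prop
  obtain ⟨θ₀, hθ₀, hgθ₀⟩ : ∃ θ ∈ Set.Icc 0 π, g θ = 1 := by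
    refine intermediate_value_Icc' pi_pos.le hgc.continuousOn ⟨?_, ?_⟩
    · simp [hg, sinc_of_ne_zero pi_ne_zero]
    · simp [hg, hk.le]
  have hθ₀π : θ₀ < π := by
    refine lt_of_le_of_ne hθ₀.2 ?_
    rintro rfl
    simp [hg, sinc_of_ne_zero pi_ne_zero] at hgθ₀
    linarith
  have hg1 : ∀ θ ∈ Set.Icc 0 θ₀, 1 ≤ g θ := fun θ hθ => by
    rw [← hgθ₀]
    exact antitoneOn_cos_add_mul_sinc hk ⟨hθ.1, hθ.2.trans hθ₀.2⟩ hθ₀ hθ.2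
  have hGc : ContinuousOn (fun θ => arcosh (g θ) + √(g θ ^ 2 - 1) / sinc θ) (Set.Icc 0 θ₀) := by
    refine (continuousOn_arcosh.comp hgc.continuousOn hg1).add (ContinuousOn.div ?_ ?_ ?_)
    · exact Continuous.continuousOn (by fun_prop)
    · exact continuous_sinc.continuousOn
    · exact fun θ hθ => (sinc_pos hθ.1 (hθ.2.trans_lt hθ₀π)).ne'
  obtain ⟨θ, hθ, hGθ⟩ := intermediate_value_Icc' hθ₀.1 hGc (show y ∈ Set.Icc _ _ by
    refine ⟨by simpa [hgθ₀] using hy, ?_⟩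
    simpa [hg] using hlt.le)
  have hθpos : 0 < θ := by
    refine lt_of_le_of_ne hθ.1 ?_
    rintro rfl
    simp [hg] at hGθ
    linarith
  have hθπ := hθ.2.trans_lt hθ₀π
  refine ⟨arcosh (g θ), θ, ⟨hθpos, hθπ, ?_⟩, ?_⟩
  · rw [cosh_arcosh (hg1 θ hθ), hg]
    simp only [sinc_of_ne_zero hθpos.ne']
    field_simp
  · rw [sinh_arcosh (hg1 θ hθ), ← hGθ]
    simp only [sinc_of_ne_zero hθpos.ne']
    have := (sin_pos_of_pos_of_lt_pi hθpos hθπ).ne'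
    field_simp

lemma exists_onRealCurve {k y : ℝ} (hk : 0 < k)
    (hlt : |y| < arcosh (1 + k) + √((1 + k) ^ 2 - 1)) :
    ∃ p θ, OnRealCurve k p θ ∧ p + θ / sin θ * sinh p = y := by
  obtain ⟨p, θ, h, hp⟩ := exists_onRealCurve_of_nonneg hk (abs_nonneg y) hlt
  rcases abs_choice y with hy | hy
  · exact ⟨p, θ, h, hp.trans hy⟩
  · refine ⟨-p, θ, ⟨h.1, h.2.1, by rw [cosh_neg]; exact h.2.2⟩, ?_⟩
    rw [sinh_neg]
    linarith

lemma cos_lt_cosh {p θ : ℝ} (h0 : 0 < θ) (hπ : θ < π) : cos θ < cosh p := by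
  have : cos θ < 1 := by
    simpa using cos_lt_cos_of_nonneg_of_le_pi le_rfl hπ.le h0
  exact this.trans_le (one_le_cosh p)

lemma halfPlanePoint_im_pos {p θ : ℝ} (h0 : 0 < θ) (hπ : θ < π) :
    0 < (halfPlanePoint p θ).im :=
  div_pos (sin_pos_of_pos_of_lt_pi h0 hπ) (by linarith [cos_lt_cosh (p := p) h0 hπ])

lemma halfPlanePoint_sub_half {p θ : ℝ} (h0 : 0 < θ) (hπ : θ < π) :
    halfPlanePoint p θ - 1 / 2 = Complex.exp ⟨p, θ⟩ * (halfPlanePoint p θ + 1 / 2) := by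
  have hD : cosh p - cos θ ≠ 0 := (sub_pos.2 (cos_lt_cosh h0 hπ)).ne'
  have h4 := sin_sq_add_cos_sq θ
  have h5 := cosh_sq p
  have h6 := cosh_add_sinh p
  apply Complex.ext
  · simp [halfPlanePoint, Complex.exp_re, Complex.exp_im]
    rw [← h6]
    field_simp
    linear_combination (cosh p + sinh p) * h4 - cos θ * h5
  · simp [halfPlanePoint, Complex.exp_re, Complex.exp_im]
    rw [← h6]
    field_simp
    linear_combination - sin θ * h5

lemma add_half_ne_zero {s : ℂ} (hs : 0 < s.im) : s + 1 / 2 ≠ 0 := by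
  intro h
  have := congrArg Complex.im h
  simp at this
  linarith

lemma log_halfPlanePoint {p θ : ℝ} (h0 : 0 < θ) (hπ : θ < π) :
    Complex.log ((halfPlanePoint p θ - 1 / 2) / (halfPlanePoint p θ + 1 / 2)) = ⟨p, θ⟩ := by
  rw [halfPlanePoint_sub_half h0 hπ,
    mul_div_cancel_right₀ _ (add_half_ne_zero (halfPlanePoint_im_pos h0 hπ)),
    Complex.log_exp (by simpa using by linarith) (by simpa using hπ.le)]

lemma exists_eq_halfPlanePoint {s : ℂ} (hs : 0 < s.im) :
    ∃ p θ, 0 < θ ∧ θ < π ∧ s = halfPlanePoint p θ := by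
  have hne := add_half_ne_zero hs
  set w := (s - 1 / 2) / (s + 1 / 2) with hw
  have hwim : 0 < w.im := by
    have hn : 0 < Complex.normSq (s + 1 / 2) := Complex.normSq_pos.2 hne
    have : w.im = s.im / Complex.normSq (s + 1 / 2) := by
      rw [hw, Complex.div_im]
      field_simp
      simp
      ring
    rw [this]
    positivity
  have hw0 : w ≠ 0 := by
    intro h
    simp [h] at hwim
  have hw1 : 1 - w ≠ 0 := by
    intro h
    have := congrArg Complex.im h
    simp at this
    linarith
  have harg0 : 0 < w.arg := by
    refine lt_of_le_of_ne (Complex.arg_nonneg_iff.2 hwim.le) fun h => ?_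
    exact hwim.ne (Complex.arg_eq_zero_iff.1 h.symm).2.symm
  have hargπ : w.arg < π := Complex.arg_lt_pi_iff.2 (Or.inr hwim.ne')
  have hexp : Complex.exp ⟨Real.log ‖w‖, w.arg⟩ = w := by
    conv_rhs => rw [← Complex.exp_log hw0]
    congr 1
    apply Complex.ext <;> simp [Complex.log_re, Complex.log_im]
  refine ⟨Real.log ‖w‖, w.arg, harg0, hargπ, ?_⟩
  have h₁ := halfPlanePoint_sub_half (p := Real.log ‖w‖) harg0 hargπ
  rw [hexp] at h₁
  have h₂ : s - 1 / 2 = w * (s + 1 / 2) := by rw [hw, div_mul_cancel₀ _ hne]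
  refine mul_left_cancel₀ hw1 ?_
  linear_combination h₂ - h₁

lemma Jmap_halfPlanePoint_eq_iff {c₁ c₀ p θ x : ℝ} (h0 : 0 < θ) (hπ : θ < π) :
    Jmap c₁ c₀ (halfPlanePoint p θ) = x ↔
      OnRealCurve (c₁ / 2) p θ ∧ p + θ / sin θ * sinh p = c₀ - x := by
  have hD : cosh p - cos θ ≠ 0 := (sub_pos.2 (cos_lt_cosh h0 hπ)).ne'
  have hs := (sin_pos_of_pos_of_lt_pi h0 hπ).ne'
  have him : c₁ * (sin θ / (2 * (cosh p - cos θ))) - θ = 0 ↔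
      θ * cosh p = θ * cos θ + c₁ / 2 * sin θ := by
    field_simp
    constructor <;> intro h <;> linarith
  have hre : OnRealCurve (c₁ / 2) p θ →
      c₁ * (-sinh p / (2 * (cosh p - cos θ))) = -(θ / sin θ * sinh p) := by
    intro h
    have h3 := h.2.2
    field_simp
    linear_combination 2 * sinh p * h3
  have hJ : Jmap c₁ c₀ (halfPlanePoint p θ) = x ↔
      c₁ * (-sinh p / (2 * (cosh p - cos θ))) + c₀ - p = x ∧
        c₁ * (sin θ / (2 * (cosh p - cos θ))) - θ = 0 := by
    rw [Jmap, log_halfPlanePoint h0 hπ, Complex.ext_iff]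
    simp only [halfPlanePoint, Complex.sub_re, Complex.add_re, Complex.re_ofReal_mul,
      Complex.ofReal_re, Complex.sub_im, Complex.add_im, Complex.im_ofReal_mul,
      Complex.ofReal_im, add_zero]
  rw [hJ, him]
  constructor
  · rintro ⟨hr, hi⟩
    have hc : OnRealCurve (c₁ / 2) p θ := ⟨h0, hπ, hi⟩
    exact ⟨hc, by linarith [hre hc]⟩
  · rintro ⟨hc, hx⟩
    exact ⟨by linarith [hre hc], hc.2.2⟩

lemma mul_sb_and_log_eq {c sb : ℝ} (hc : 0 < c) (hsb : sb = √(1 / 4 + 1 / c)) :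
    c * sb = √((1 + c / 2) ^ 2 - 1) ∧
      log ((sb - 1 / 2) / (sb + 1 / 2)) = -arcosh (1 + c / 2) := by
  have hsq : sb ^ 2 = 1 / 4 + 1 / c := by rw [hsb, sq_sqrt (by positivity)]
  have hcsq : c * sb ^ 2 = c / 4 + 1 := by rw [hsq]; field_simp
  have hgt : 1 / 2 < sb := by
    rw [hsb]
    refine lt_sqrt_of_sq_lt ?_
    have : 0 < 1 / c := by positivity
    linarith
  have hroot : c * sb = √((1 + c / 2) ^ 2 - 1) := by
    have : (1 + c / 2) ^ 2 - 1 = (c * sb) ^ 2 := by linear_combination -c * hcsq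
    rw [this, sqrt_sq (mul_pos hc (by linarith)).le]
  refine ⟨hroot, ?_⟩
  have hm : sb - 1 / 2 ≠ 0 := (sub_pos.2 hgt).ne'
  rw [arcosh, ← hroot, ← log_inv, ← inv_div]
  congr 2
  rw [div_eq_iff hm]
  linear_combination -hcsq

end Real

/-- With `s_b = √(1/4 + 1/c₁)`, `s_a = −s_b`, `a = J(s_a)` and `b = J(s_b)`:
for `a < x < b` the equation `J_{c₁,c₀}(s) = x` has exactly one solution in the open upper half
plane, while for `x ≤ a` or `x ≥ b` it has none. -/
theorem Jmap_upper_half_solutions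
    (c₁ c₀ : ℝ) (hc₁ : 0 < c₁) (sb a b : ℝ)
    (hsb : sb = Real.sqrt (1/4 + 1/c₁))
    (ha : a = c₁ * (-sb) + c₀ - Real.log ((-sb - 1/2) / (-sb + 1/2)))
    (hb : b = c₁ * sb + c₀ - Real.log ((sb - 1/2) / (sb + 1/2))) :
    (∀ x : ℝ, a < x → x < b → ∃! s : ℂ, 0 < s.im ∧ Jmap c₁ c₀ s = (x : ℂ)) ∧
    (∀ x : ℝ, x ≤ a ∨ b ≤ x → ¬ ∃ s : ℂ, 0 < s.im ∧ Jmap c₁ c₀ s = (x : ℂ)) := by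
  obtain ⟨h₁, h₂⟩ := mul_sb_and_log_eq hc₁ hsb
  have hk : 0 < c₁ / 2 := by positivity
  have hinv : (-sb - 1/2) / (-sb + 1/2) = ((sb - 1/2) / (sb + 1/2))⁻¹ := by
    rw [inv_div, ← neg_div_neg_eq]
    ring_nf
  rw [hinv, Real.log_inv, h₂, mul_neg, h₁] at ha
  rw [h₂, h₁] at hb
  refine ⟨fun x hax hxb => ?_, ?_⟩
  · obtain ⟨p, θ, h, hx⟩ := exists_onRealCurve (y := c₀ - x) hk
      (abs_lt.2 ⟨by linarith, by linarith⟩)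
    refine ⟨halfPlanePoint p θ, ⟨halfPlanePoint_im_pos h.1 h.2.1,
      (Jmap_halfPlanePoint_eq_iff h.1 h.2.1).2 ⟨h, hx⟩⟩, ?_⟩
    rintro s ⟨hs, hJ⟩
    obtain ⟨p', θ', h0, hπ, rfl⟩ := exists_eq_halfPlanePoint hs
    obtain ⟨h', hx'⟩ := (Jmap_halfPlanePoint_eq_iff h0 hπ).1 hJ
    obtain ⟨rfl, rfl⟩ := h'.eq_of_eq hk h (hx'.trans hx.symm)
    rfl
  · rintro x hx ⟨s, hs, hJ⟩
    obtain ⟨p, θ, h0, hπ, rfl⟩ := exists_eq_halfPlanePoint hs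
    obtain ⟨h, hxp⟩ := (Jmap_halfPlanePoint_eq_iff h0 hπ).1 hJ
    have hlt := h.abs_lt hk
    rw [hxp, _root_.abs_lt] at hlt
    rcases hx with hx | hx <;> linarith [hlt.1, hlt.2]
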